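/- If the smooth field φ satisfies the Euler–Lagrange equations E_A ≡ 0, then for every μ the Noether current obeys the energy-flux identity ∂_0 H^μ = ∂_0( Σ_A π_A^μ ∂_0 φ^A ) − δ^μ_0 Σ_σ ∂_σ( Σ_A π_A^σ ∂_0 φ^A ); equivalently, ∂_0 H^μ = 2 ∂_σ( X^{[σ} π_A^{μ]} ∂_0 φ^A ) with X = ∂_0. -/

import Mathlib

/-!
Statement 1: For a smooth first-order Lagrangian `L` and a smooth field `φ`,
the divergence of the Noether (canonical energy) current associated with the
translation `X = ∂₀` equals `Σ_A E_A ∂₀φ^A`.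
-/

noncomputable section

open scoped BigOperators

/-- Partial derivative of a real-valued function on `Fin n → ℝ` along coordinate `i`. -/
def pd {n : ℕ} (i : Fin n) (f : (Fin n → ℝ) → ℝ) (x : Fin n → ℝ) : ℝ :=
  fderiv ℝ f x (Pi.single i 1)

/-- First jet of a field. -/
def jet {m n : ℕ} (φ : (Fin n → ℝ) → (Fin m → ℝ)) (x : Fin n → ℝ) :
    (Fin m → ℝ) × (Fin m → Fin n → ℝ) :=
  (φ x, fun A μ => pd μ (fun y => φ y A) x)

/-- Canonical momentum `π_A^μ`: derivative of `L` with respect to the derivative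
slot `φ^A_μ`, evaluated at the first jet of `φ`. -/
def mom {m n : ℕ} (L : (Fin m → ℝ) × (Fin m → Fin n → ℝ) → ℝ)
    (φ : (Fin n → ℝ) → (Fin m → ℝ)) (A : Fin m) (μ : Fin n) (x : Fin n → ℝ) : ℝ :=
  fderiv ℝ L (jet φ x) (0, Pi.single A (Pi.single μ 1))

/-- `π_A`: derivative of `L` with respect to the field slot `φ^A`, evaluated at
the first jet of `φ`. -/
def momF {m n : ℕ} (L : (Fin m → ℝ) × (Fin m → Fin n → ℝ) → ℝ)
    (φ : (Fin n → ℝ) → (Fin m → ℝ)) (A : Fin m) (x : Fin n → ℝ) : ℝ :=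
  fderiv ℝ L (jet φ x) (Pi.single A 1, 0)

/-- Euler–Lagrange expression `E_A = Σ_μ ∂_μ π_A^μ − π_A`. -/
def EL {m n : ℕ} (L : (Fin m → ℝ) × (Fin m → Fin n → ℝ) → ℝ)
    (φ : (Fin n → ℝ) → (Fin m → ℝ)) (A : Fin m) (x : Fin n → ℝ) : ℝ :=
  (∑ μ, pd μ (mom L φ A μ) x) - momF L φ A x

/-- Noether (canonical energy) current `H^μ = Σ_A π_A^μ ∂₀φ^A − δ^μ₀ L(j(x))`. -/
def noether {m n : ℕ} [NeZero n] (L : (Fin m → ℝ) × (Fin m → Fin n → ℝ) → ℝ)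
    (φ : (Fin n → ℝ) → (Fin m → ℝ)) (μ : Fin n) (x : Fin n → ℝ) : ℝ :=
  (∑ A, mom L φ A μ x * pd 0 (fun y => φ y A) x)
    - (if μ = 0 then L (jet φ x) else 0)

section PartialDerivatives

variable {n : ℕ} {f g : (Fin n → ℝ) → ℝ}

lemma ContDiff.pd (hf : ContDiff ℝ (⊤ : ℕ∞) f) (i : Fin n) :
    ContDiff ℝ (⊤ : ℕ∞) (pd i f) :=
  (hf.fderiv_right (m := (⊤ : ℕ∞)) (by norm_cast)).clm_apply contDiff_const

lemma pd_sub (i : Fin n) {x : Fin n → ℝ} (hf : DifferentiableAt ℝ f x)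
    (hg : DifferentiableAt ℝ g x) :
    pd i (fun y => f y - g y) x = pd i f x - pd i g x := by
  simp [pd, fderiv_fun_sub hf hg]

lemma pd_mul (i : Fin n) {x : Fin n → ℝ} (hf : DifferentiableAt ℝ f x)
    (hg : DifferentiableAt ℝ g x) :
    pd i (fun y => f y * g y) x = f x * pd i g x + pd i f x * g x := by
  simp [pd, fderiv_fun_mul hf hg, mul_comm]

lemma pd_sum {ι : Type*} [Fintype ι] {F : ι → (Fin n → ℝ) → ℝ} (i : Fin n) {x : Fin n → ℝ}
    (hF : ∀ a, DifferentiableAt ℝ (F a) x) :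
    pd i (fun y => ∑ a, F a y) x = ∑ a, pd i (F a) x := by
  simp [pd, fderiv_fun_sum fun a _ => hF a]

/-- Partial derivatives of a smooth function commute. -/
lemma pd_comm (hf : ContDiff ℝ (⊤ : ℕ∞) f) (i j : Fin n) (x : Fin n → ℝ) :
    pd i (pd j f) x = pd j (pd i f) x := by
  have hd : DifferentiableAt ℝ (fderiv ℝ f) x :=
    ((hf.fderiv_right (m := (⊤ : ℕ∞)) (by norm_cast)).differentiable (by simp)).differentiableAt
  have key (k l : Fin n) :
      pd k (pd l f) x = fderiv ℝ (fderiv ℝ f) x (Pi.single k 1) (Pi.single l 1) := by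
    change fderiv ℝ (fun y => fderiv ℝ f y (Pi.single l 1)) x (Pi.single k 1) = _
    rw [fderiv_clm_apply hd (differentiableAt_const _)]
    simp
  rw [key, key]
  exact hf.contDiffAt.isSymmSndFDerivAt (by simp; norm_cast) _ _

end PartialDerivatives

section Jets

variable {m n : ℕ} {L : (Fin m → ℝ) × (Fin m → Fin n → ℝ) → ℝ} {φ : (Fin n → ℝ) → (Fin m → ℝ)}

lemma contDiff_jet (hφ : ContDiff ℝ (⊤ : ℕ∞) φ) : ContDiff ℝ (⊤ : ℕ∞) (jet φ) :=
  hφ.prodMk <| contDiff_pi.2 fun A => contDiff_pi.2 fun μ => (contDiff_pi.1 hφ A).pd μ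

lemma contDiff_mom (hL : ContDiff ℝ (⊤ : ℕ∞) L) (hφ : ContDiff ℝ (⊤ : ℕ∞) φ) (A : Fin m)
    (μ : Fin n) : ContDiff ℝ (⊤ : ℕ∞) (mom L φ A μ) :=
  ((hL.fderiv_right (m := (⊤ : ℕ∞)) (by norm_cast)).comp (contDiff_jet hφ)).clm_apply
    contDiff_const

lemma jet_direction_eq_sum (v : (Fin m → ℝ) × (Fin m → Fin n → ℝ)) :
    v = ∑ A, (v.1 A • ((Pi.single A 1, 0) : (Fin m → ℝ) × (Fin m → Fin n → ℝ))
      + ∑ μ, v.2 A μ •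
        ((0, Pi.single A (Pi.single μ 1)) : (Fin m → ℝ) × (Fin m → Fin n → ℝ))) := by
  refine Prod.ext ?_ ?_
  · ext B
    simp [Prod.fst_sum, Finset.sum_apply, Pi.single_apply]
  · ext B ν
    simp [Prod.snd_sum, Finset.sum_apply, Pi.single_apply, ite_apply]

/-- The chain rule for the Lagrangian evaluated along the first jet of a field. -/
lemma pd_lagrangian (hL : ContDiff ℝ (⊤ : ℕ∞) L) (hφ : ContDiff ℝ (⊤ : ℕ∞) φ) (i : Fin n)
    (x : Fin n → ℝ) :
    pd i (fun y => L (jet φ y)) x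
      = ∑ A, (momF L φ A x * pd i (fun y => φ y A) x
        + ∑ μ, mom L φ A μ x * pd i (pd μ (fun y => φ y A)) x) := by
  have hjet : DifferentiableAt ℝ (jet φ) x := (contDiff_jet hφ).differentiable (by simp) x
  have h1 (A : Fin m) :
      (fderiv ℝ (jet φ) x (Pi.single i 1)).1 A = pd i (fun y => φ y A) x := by
    have h := ((ContinuousLinearMap.proj (R := ℝ) (φ := fun _ : Fin m => ℝ) A).comp
      (ContinuousLinearMap.fst ℝ (Fin m → ℝ) (Fin m → Fin n → ℝ))).hasFDerivAt.comp x
        hjet.hasFDerivAt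
    exact (congrArg (fun T => T (Pi.single i 1)) h.fderiv).symm
  have h2 (A : Fin m) (μ : Fin n) :
      (fderiv ℝ (jet φ) x (Pi.single i 1)).2 A μ = pd i (pd μ (fun y => φ y A)) x := by
    have h := (((ContinuousLinearMap.proj (R := ℝ) (φ := fun _ : Fin n => ℝ) μ).comp
      (ContinuousLinearMap.proj (R := ℝ) (φ := fun _ : Fin m => Fin n → ℝ) A)).comp
      (ContinuousLinearMap.snd ℝ (Fin m → ℝ) (Fin m → Fin n → ℝ))).hasFDerivAt.comp x
        hjet.hasFDerivAt
    exact (congrArg (fun T => T (Pi.single i 1)) h.fderiv).symm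
  have hchain : pd i (fun y => L (jet φ y)) x
      = fderiv ℝ L (jet φ x) (fderiv ℝ (jet φ) x (Pi.single i 1)) := by
    have h := (hL.differentiable (by simp) (jet φ x)).hasFDerivAt.comp x hjet.hasFDerivAt
    exact congrArg (fun T => T (Pi.single i 1)) h.fderiv
  rw [hchain, jet_direction_eq_sum (fderiv ℝ (jet φ) x (Pi.single i 1))]
  simp only [map_sum, map_add, map_smul, smul_eq_mul, h1, h2]
  simp only [momF, mom, mul_comm]

/-- On solutions of the Euler–Lagrange equations, the derivative of the Lagrangian along a
coordinate is a total divergence. -/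
lemma pd_lagrangian_eq_divergence (hL : ContDiff ℝ (⊤ : ℕ∞) L) (hφ : ContDiff ℝ (⊤ : ℕ∞) φ)
    {x : Fin n → ℝ} (hEL : ∀ A, EL L φ A x = 0) (i : Fin n) :
    pd i (fun y => L (jet φ y)) x
      = ∑ σ, pd σ (fun y => ∑ A, mom L φ A σ y * pd i (fun z => φ z A) y) x := by
  have hφA (A : Fin m) : ContDiff ℝ (⊤ : ℕ∞) (fun y => φ y A) := contDiff_pi.1 hφ A
  have hmom (A : Fin m) (σ : Fin n) : DifferentiableAt ℝ (mom L φ A σ) x :=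
    (contDiff_mom hL hφ A σ).differentiable (by simp) x
  have hpd (A : Fin m) : DifferentiableAt ℝ (pd i fun z => φ z A) x :=
    ((hφA A).pd i).differentiable (by simp) x
  have hdiv (σ : Fin n) : pd σ (fun y => ∑ A, mom L φ A σ y * pd i (fun z => φ z A) y) x
      = ∑ A, (mom L φ A σ x * pd σ (pd i fun z => φ z A) x
        + pd σ (mom L φ A σ) x * pd i (fun z => φ z A) x) := by
    rw [pd_sum (F := fun A y => mom L φ A σ y * pd i (fun z => φ z A) y) σ
      fun A => (hmom A σ).mul (hpd A)]
    exact Finset.sum_congr rfl fun A _ => pd_mul σ (hmom A σ) (hpd A)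
  rw [pd_lagrangian hL hφ, Finset.sum_congr rfl fun σ _ => hdiv σ, Finset.sum_comm]
  refine Finset.sum_congr rfl fun A _ => ?_
  rw [← sub_eq_zero.1 (hEL A), Finset.sum_mul, ← Finset.sum_add_distrib]
  refine Finset.sum_congr rfl fun σ _ => ?_
  rw [pd_comm (hφA A) i σ, add_comm]

end Jets

/-- if `φ` satisfies the Euler–Lagrange equations `E_A ≡ 0`, then
the Noether current obeys the energy-flux identity
`∂₀H^μ = ∂₀(Σ_A π_A^μ ∂₀φ^A) − δ^μ₀ Σ_σ ∂_σ(Σ_A π_A^σ ∂₀φ^A)`,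
i.e. `∂₀H^μ = 2∂_σ(X^{[σ}π_A^{μ]}∂₀φ^A)` with `X = ∂₀`. -/
theorem energy_flux {m n : ℕ} [NeZero n]
    (L : (Fin m → ℝ) × (Fin m → Fin n → ℝ) → ℝ) (hL : ContDiff ℝ (⊤ : ℕ∞) L)
    (φ : (Fin n → ℝ) → (Fin m → ℝ)) (hφ : ContDiff ℝ (⊤ : ℕ∞) φ)
    (hEL : ∀ A x, EL L φ A x = 0) (μ : Fin n) (x : Fin n → ℝ) :
    pd 0 (noether L φ μ) x
      = pd 0 (fun y => ∑ A, mom L φ A μ y * pd 0 (fun z => φ z A) y) x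
        - (if μ = 0 then
            ∑ σ, pd σ (fun y => ∑ A, mom L φ A σ y * pd 0 (fun z => φ z A) y) x
          else 0) := by
  have hcur : DifferentiableAt ℝ (fun y => ∑ A, mom L φ A μ y * pd 0 (fun z => φ z A) y) x :=
    (ContDiff.sum fun A _ =>
      (contDiff_mom hL hφ A μ).mul ((contDiff_pi.1 hφ A).pd 0)).differentiable (by simp) x
  have hLag : DifferentiableAt ℝ (fun y => L (jet φ y)) x :=
    (hL.comp (contDiff_jet hφ)).differentiable (by simp) x
  split_ifs with hμ
  · rw [← pd_lagrangian_eq_divergence hL hφ (fun A => hEL A x) 0, ← pd_sub 0 hcur hLag]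
    congr 1
    funext y
    simp [noether, hμ]
  · rw [sub_zero]
    congr 1
    funext y
    simp [noether, hμ]
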